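/- Lemma 1: the maximum of D(P_{T|Y∈A} ‖ P_T) over all nonempty subsets A ⊆ 𝒞 equals the maximum of D(P_{T|Y=y} ‖ P_T) over all single classes y ∈ 𝒞; that is, max_{∅≠A⊆𝒞} D(P_{T|Y∈A} ‖ P_T) = max_{y∈𝒞} D(P_{T|Y=y} ‖ P_T). -/

import Mathlib

open Finset

/-- Kullback-Leibler divergence between two pmfs on a finite set,
`D(p‖q) = ∑_{t : p(t) > 0} p(t) log (p(t)/q(t))`. -/
noncomputable def klD {T : Type*} [Fintype T] (p q : T → ℝ) : ℝ :=
  ∑ t, if 0 < p t then p t * Real.log (p t / q t) else 0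

lemma klD_eq_aux {T : Type*} [Fintype T] (p q : T → ℝ) (hp : ∀ t, 0 ≤ p t)
    (hpq : ∀ t, q t = 0 → p t = 0) :
    klD p q = ∑ t, (p t * Real.log (p t) - p t * Real.log (q t)) := by
  unfold klD
  refine Finset.sum_congr rfl fun t _ => ?_
  split_ifs with h
  · have hq : q t ≠ 0 := fun h0 => h.ne' (hpq t h0)
    rw [Real.log_div h.ne' hq]; ring
  · have : p t = 0 := le_antisymm (not_lt.mp h) (hp t)
    simp [this]

lemma klD_conv_aux {T C : Type*} [Fintype T] (A : Finset C) (w : C → ℝ) (p : C → T → ℝ)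
    (q : T → ℝ) (hw : ∀ c ∈ A, 0 ≤ w c) (hw1 : ∑ c ∈ A, w c = 1)
    (hp : ∀ c t, 0 ≤ p c t) (hpq : ∀ c t, q t = 0 → p c t = 0) :
    klD (fun t => ∑ c ∈ A, w c * p c t) q ≤ ∑ c ∈ A, w c * klD (p c) q := by
  rw [klD_eq_aux _ _ (fun t => Finset.sum_nonneg fun c hc => mul_nonneg (hw c hc) (hp c t))
    (fun t ht => Finset.sum_eq_zero fun c _ => by rw [hpq c t ht, mul_zero])]
  simp_rw [fun c => klD_eq_aux (p c) q (hp c) (hpq c), Finset.mul_sum]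
  rw [Finset.sum_comm]
  refine Finset.sum_le_sum fun t _ => ?_
  have h := Real.convexOn_mul_log.map_sum_le (t := A) (w := w) (p := fun c => p c t) hw hw1
    (fun c _ => hp c t)
  simp only [smul_eq_mul] at h
  simp_rw [mul_sub, Finset.sum_sub_distrib, ← mul_assoc, ← Finset.sum_mul]
  simp_rw [← mul_assoc] at h
  linarith

/-- Lemma 1: `max_{∅≠A⊆𝒞} D(P_{T|Y∈A} ‖ P_T) = max_{y∈𝒞} D(P_{T|Y=y} ‖ P_T)`. -/
theorem stmt_1 {T C : Type*} [Fintype T] [Fintype C] [Nonempty T] [Nonempty C]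
    [DecidableEq C]
    (P : T → C → ℝ)
    (hP0 : ∀ t c, 0 ≤ P t c)
    (hP1 : ∑ t, ∑ c, P t c = 1)
    (hPY : ∀ c, 0 < ∑ t, P t c)
    (hS : ((Finset.univ : Finset (Finset C)).filter (fun A => A ≠ ∅)).Nonempty) :
    ((Finset.univ : Finset (Finset C)).filter (fun A => A ≠ ∅)).sup' hS
        (fun A => klD (fun t => (∑ c ∈ A, P t c) / (∑ c ∈ A, ∑ t', P t' c))
          (fun t => ∑ c, P t c))
      = (Finset.univ : Finset C).sup' Finset.univ_nonempty
          (fun y => klD (fun t => P t y / ∑ t', P t' y) (fun t => ∑ c, P t c)) := by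
  have hY : ∀ A : Finset C, A ≠ ∅ → 0 < ∑ c ∈ A, ∑ t', P t' c := fun A hA =>
    Finset.sum_pos (fun c _ => hPY c) (Finset.nonempty_iff_ne_empty.mpr hA)
  apply le_antisymm
  · refine Finset.sup'_le _ _ fun A hA => ?_
    have hA' : A ≠ ∅ := (Finset.mem_filter.mp hA).2
    have hpos := hY A hA'
    set S := ∑ c ∈ A, ∑ t', P t' c with hSdef
    have hw : ∀ c ∈ A, 0 ≤ (∑ t', P t' c) / S := fun c _ => div_nonneg (hPY c).le hpos.le
    have hw1 : ∑ c ∈ A, (∑ t', P t' c) / S = 1 := by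
      rw [← Finset.sum_div, ← hSdef, div_self hpos.ne']
    have key := klD_conv_aux A (fun c => (∑ t', P t' c) / S)
      (fun c t => P t c / ∑ t', P t' c) (fun t => ∑ c, P t c) hw hw1
      (fun c t => div_nonneg (hP0 t c) (hPY c).le)
      (fun c t h0 => by
        have := (Finset.sum_eq_zero_iff_of_nonneg (fun c _ => hP0 t c)).mp h0 c (Finset.mem_univ c)
        simp [this])
    have e : (fun t => (∑ c ∈ A, P t c) / S) =
        fun t => ∑ c ∈ A, (∑ t', P t' c) / S * (P t c / ∑ t', P t' c) := by
      funext t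
      rw [Finset.sum_div]
      refine Finset.sum_congr rfl fun c _ => ?_
      have := (hPY c).ne'
      field_simp
    rw [e]
    refine key.trans ?_
    rw [← one_mul (Finset.sup' _ _ _), ← hw1, Finset.sum_mul]
    refine Finset.sum_le_sum fun c hc => mul_le_mul_of_nonneg_left ?_ (hw c hc)
    exact Finset.le_sup' (fun y => klD (fun t => P t y / ∑ t', P t' y) (fun t => ∑ c, P t c))
      (Finset.mem_univ c)
  · refine Finset.sup'_le _ _ fun y _ => ?_
    have := Finset.le_sup' (s := (Finset.univ : Finset (Finset C)).filter (fun A => A ≠ ∅))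
      (fun A => klD (fun t => (∑ c ∈ A, P t c) / (∑ c ∈ A, ∑ t', P t' c))
          (fun t => ∑ c, P t c)) (b := {y}) (by simp)
    simpa only [Finset.sum_singleton] using this
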